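/- arXiv:1911.06757 — 12 statements merged into one kernel-verified Lean document; each statement's English description precedes it below -/
import Mathlib

section
/- Let M = (G, H, (v_i)) be a graphical matching problem instance whose player graph G is symmetric, and define φ(π) = Σ_{i∈N} (v_i(π(i)) + u_i(π)). If π →_{i,j} π' is a blocking-pair resolution (i.e., (i,j) is a blocking pair in π and π' is its resolution), then φ(π') > φ(π). -/
open scoped Classical

/-- A graphical matching problem instance: a player graph `(tau, w)` on players `N`
(no self-loops), an item graph `lam` on items `A` (symmetric, irreflexive), and
nonnegative valuations `v`. -/
structure GMP (N A : Type*) [Fintype N] [Fintype A] where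
  tau : N → N → Prop
  w : N → N → ℝ
  noSelf : ∀ i, ¬ tau i i
  lam : A → A → Prop
  lamSymm : ∀ a b, lam a b → lam b a
  lamIrrefl : ∀ a, ¬ lam a a
  v : N → A → ℝ
  vNonneg : ∀ i a, 0 ≤ v i a

variable {N A : Type*} [Fintype N] [Fintype A]

/-- The utility of player `i` under allocation `π`. -/
noncomputable def GMP.utility (M : GMP N A) (π : N ≃ A) (i : N) : ℝ :=
  M.v i (π i) +
    ∑ j ∈ Finset.univ.filter (fun j => M.tau j i ∧ M.lam (π j) (π i)), M.w j i

/-- The allocation obtained from `π` by swapping the items of `i` and `j`. -/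
noncomputable def swapAlloc (π : N ≃ A) (i j : N) : N ≃ A := (Equiv.swap i j).trans π

/-- `(i, j)` is a blocking pair in `π`. -/
def GMP.BlockingPair (M : GMP N A) (π : N ≃ A) (i j : N) : Prop :=
  i ≠ j ∧ M.utility π i < M.utility (swapAlloc π i j) i ∧
    M.utility π j < M.utility (swapAlloc π i j) j

/-- An allocation is 2-stable if it has no blocking pair. -/
def GMP.TwoStable (M : GMP N A) (π : N ≃ A) : Prop :=
  ∀ i j, ¬ M.BlockingPair π i j

/-- The player graph is symmetric. -/
def GMP.Symm (M : GMP N A) : Prop :=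
  ∀ i j, M.tau i j → M.tau j i ∧ M.w i j = M.w j i

/-- The potential function `φ(π) = Σ_i (v_i(π(i)) + u_i(π))`. -/
noncomputable def GMP.phi (M : GMP N A) (π : N ≃ A) : ℝ :=
  ∑ i, (M.v i (π i) + M.utility π i)

/-- Social welfare. -/
noncomputable def GMP.SW (M : GMP N A) (π : N ≃ A) : ℝ :=
  ∑ i, M.utility π i

/-- `X` is a blocking coalition in `π` witnessed by `π'`. -/
def GMP.BlocksVia (M : GMP N A) (π : N ≃ A) (X : Finset N) (π' : N ≃ A) : Prop :=
  X.Nonempty ∧ ∃ μ : N → N, Set.BijOn μ ↑X ↑X ∧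
    (∀ k, k ∉ X → π' k = π k) ∧
    ∀ i ∈ X, π' i = π (μ i) ∧ π' i ≠ π i ∧ M.utility π i < M.utility π' i

/-- `X` is a blocking coalition in `π`. -/
def GMP.BlockingCoalition (M : GMP N A) (π : N ≃ A) (X : Finset N) : Prop :=
  ∃ π' : N ≃ A, M.BlocksVia π X π'

/-- An allocation is core stable if it has no blocking coalition. -/
def GMP.CoreStable (M : GMP N A) (π : N ≃ A) : Prop :=
  ∀ X : Finset N, ¬ M.BlockingCoalition π X

/-- An allocation is envy-free if no player strictly gains from a (unilateral) swap. -/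
def GMP.EnvyFree (M : GMP N A) (π : N ≃ A) : Prop :=
  ∀ i j, ¬ M.utility π i < M.utility (swapAlloc π i j) i

/-- The double sum of a symmetric function supported on pairs with exactly one entry
in `{i, j}` is twice the sum of the rows `i` and `j`. -/
theorem sum_sum_eq_two_mul_row_add_row {ι : Type*} [Fintype ι] (g : ι → ι → ℝ) {i j : ι}
    (hij : i ≠ j) (hsymm : ∀ k l, g k l = g l k)
    (hzero : ∀ k l, (k = i ∨ k = j ↔ l = i ∨ l = j) → g k l = 0) :
    ∑ k, ∑ l, g k l = 2 * (∑ l, g i l + ∑ l, g j l) := by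
  have hdecomp : ∀ k l, g k l = (if k = i then g i l else 0) + (if k = j then g j l else 0) +
      ((if l = i then g i k else 0) + (if l = j then g j k else 0)) := by
    intro k l
    have h1 := hzero k l
    have h2 := hsymm k l
    by_cases hki : k = i <;> by_cases hkj : k = j <;> by_cases hli : l = i <;>
      by_cases hlj : l = j <;> simp_all
  have hrow (m : ι) : ∑ k, ∑ l, (if k = m then g m l else 0) = ∑ l, g m l := by
    rw [Finset.sum_comm]
    simp
  calc ∑ k, ∑ l, g k l
      = ∑ k, ∑ l, ((if k = i then g i l else 0) + (if k = j then g j l else 0) +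
          ((if l = i then g i k else 0) + (if l = j then g j k else 0))) :=
        Finset.sum_congr rfl fun k _ => Finset.sum_congr rfl fun l _ => hdecomp k l
    _ = 2 * (∑ l, g i l + ∑ l, g j l) := by
        simp only [Finset.sum_add_distrib, hrow]
        simp only [Finset.sum_ite_eq', Finset.mem_univ, if_true]
        ring

/-- The contribution of player `l` to the utility of player `k` under `π`. -/
noncomputable def GMP.influence {N A : Type*} [Fintype N] [Fintype A] (M : GMP N A)
    (π : N ≃ A) (k l : N) : ℝ :=
  if M.tau l k ∧ M.lam (π l) (π k) then M.w l k else 0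

theorem GMP.utility_eq_add_sum_influence {N A : Type*} [Fintype N] [Fintype A] (M : GMP N A)
    (π : N ≃ A) (k : N) : M.utility π k = M.v k (π k) + ∑ l, M.influence π k l := by
  simp only [GMP.utility, GMP.influence, Finset.sum_filter]

theorem GMP.Symm.influence_comm {N A : Type*} [Fintype N] [Fintype A] {M : GMP N A}
    (hsym : M.Symm) (π : N ≃ A) (k l : N) : M.influence π k l = M.influence π l k := by
  have h1 := hsym k l
  have h2 := hsym l k
  have h3 := M.lamSymm (π k) (π l)
  have h4 := M.lamSymm (π l) (π k)
  unfold GMP.influence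
  grind

theorem swapAlloc_left {N A : Type*} (π : N ≃ A) (i j : N) : swapAlloc π i j i = π j := by
  simp [swapAlloc]

theorem swapAlloc_right {N A : Type*} (π : N ≃ A) (i j : N) : swapAlloc π i j j = π i := by
  simp [swapAlloc]

theorem swapAlloc_of_ne {N A : Type*} (π : N ≃ A) {i j k : N} (hi : k ≠ i) (hj : k ≠ j) :
    swapAlloc π i j k = π k := by
  simp [swapAlloc, Equiv.swap_apply_of_ne_of_ne hi hj]

/-- A swap of `i` and `j` only changes influences between `{i, j}` and its complement. -/
theorem GMP.influence_swapAlloc {N A : Type*} [Fintype N] [Fintype A] (M : GMP N A)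
    (π : N ≃ A) {i j k l : N} (h : k = i ∨ k = j ↔ l = i ∨ l = j) :
    M.influence (swapAlloc π i j) k l = M.influence π k l := by
  have h1 := M.noSelf
  have h2 := M.lamSymm (π i) (π j)
  have h3 := M.lamSymm (π j) (π i)
  have h4 := swapAlloc_left π i j
  have h5 := swapAlloc_right π i j
  by_cases hk : k = i ∨ k = j
  · have hl := h.mp hk
    unfold GMP.influence
    rcases hk with rfl | rfl <;> rcases hl with rfl | rfl <;> grind
  · have hl := mt h.mpr hk
    push Not at hk hl
    simp only [GMP.influence, swapAlloc_of_ne π hk.1 hk.2, swapAlloc_of_ne π hl.1 hl.2]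

/-- A swap of `i` and `j` changes the total valuation only through the
valuations of `i` and `j`. -/
theorem GMP.sum_v_swapAlloc_sub {N A : Type*} [Fintype N] [Fintype A] (M : GMP N A)
    (π : N ≃ A) {i j : N} (hij : i ≠ j) :
    ∑ k, (M.v k (swapAlloc π i j k) - M.v k (π k)) =
      (M.v i (swapAlloc π i j i) - M.v i (π i)) + (M.v j (swapAlloc π i j j) - M.v j (π j)) :=
  Fintype.sum_eq_add i j hij fun k hk => by rw [swapAlloc_of_ne π hk.1 hk.2, sub_self]

/-- The potential changes by twice the total change of utility of the swapped players. -/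
theorem GMP.Symm.phi_swapAlloc_sub {N A : Type*} [Fintype N] [Fintype A] {M : GMP N A}
    (hsym : M.Symm) (π : N ≃ A) {i j : N} (hij : i ≠ j) :
    M.phi (swapAlloc π i j) - M.phi π =
      2 * ((M.utility (swapAlloc π i j) i - M.utility π i) +
        (M.utility (swapAlloc π i j) j - M.utility π j)) := by
  have hv := GMP.sum_v_swapAlloc_sub M π hij
  have hw := sum_sum_eq_two_mul_row_add_row
    (fun k l => M.influence (swapAlloc π i j) k l - M.influence π k l) hij
    (fun k l => by
      rw [hsym.influence_comm (swapAlloc π i j) k l, hsym.influence_comm π k l])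
    (fun k l h => sub_eq_zero.mpr (M.influence_swapAlloc π h))
  simp only [Finset.sum_sub_distrib] at hv hw
  simp only [GMP.phi, GMP.utility_eq_add_sum_influence, Finset.sum_add_distrib]
  linarith

/-- In a symmetric GMP instance, resolving a blocking pair strictly
increases the potential `φ(π) = Σ_i (v_i(π(i)) + u_i(π))`. -/
theorem stmt0 {N A : Type*} [Fintype N] [Fintype A] (M : GMP N A)
    (hsym : M.Symm) (π : N ≃ A) (i j : N) (hblock : M.BlockingPair π i j) :
    M.phi π < M.phi (swapAlloc π i j) := by
  obtain ⟨hij, hi, hj⟩ := hblock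
  have h := hsym.phi_swapAlloc_sub π hij
  linarith
end

section
/- Every graphical matching problem instance whose player graph is symmetric admits a 2-stable allocation, i.e., an allocation containing no blocking pair. -/
open scoped Classical

variable {N A : Type*} [Fintype N] [Fintype A]

theorem sum_sum_eq_two_mul_of_symm_of_support {d : N → N → ℝ} {i j : N} (hij : i ≠ j)
    (hsymm : ∀ k l, d k l = d l k)
    (hoff : ∀ k l, k ≠ i → k ≠ j → l ≠ i → l ≠ j → d k l = 0)
    (hi : d i i = 0) (hj : d j j = 0) (hd : d i j = 0) :
    ∑ k, ∑ l, d l k = 2 * (∑ l, d l i + ∑ l, d l j) := by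
  have hpt : ∀ k l, d l k = (if k = i then d l i else 0) + (if k = j then d l j else 0) +
      ((if l = i then d k i else 0) + (if l = j then d k j else 0)) := by
    intro k l
    have hji : d j i = 0 := hsymm j i ▸ hd
    have hkl := hsymm k l
    have hz := hoff k l
    clear hsymm hoff
    grind
  have hcol : ∀ m, ∑ k, ∑ l, (if k = m then d l m else 0) = ∑ l, d l m := by
    intro m
    rw [Finset.sum_comm]
    simp
  rw [Finset.sum_congr rfl fun k _ => Finset.sum_congr rfl fun l _ => hpt k l]
  simp only [Finset.sum_add_distrib, hcol, Finset.sum_ite_eq', Finset.mem_univ, if_true]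
  ring

namespace GMP

/-- The contribution of player `k` to the utility of player `l` under `π`. -/
noncomputable def contribution (M : GMP N A) (π : N ≃ A) (k l : N) : ℝ :=
  if M.tau k l ∧ M.lam (π k) (π l) then M.w k l else 0

theorem utility_eq_add_sum_contribution (M : GMP N A) (π : N ≃ A) (i : N) :
    M.utility π i = M.v i (π i) + ∑ k, M.contribution π k i := by
  simp [utility, contribution, Finset.sum_filter]

theorem contribution_self (M : GMP N A) (π : N ≃ A) (i : N) : M.contribution π i i = 0 := by
  simp [contribution, M.noSelf]

theorem Symm.contribution_comm {M : GMP N A} (hsym : M.Symm) (π : N ≃ A) (k l : N) :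
    M.contribution π k l = M.contribution π l k := by
  have hlam : M.lam (π k) (π l) ↔ M.lam (π l) (π k) := ⟨M.lamSymm _ _, M.lamSymm _ _⟩
  by_cases h : M.tau k l
  · simp [contribution, h, (hsym k l h).1, (hsym k l h).2, hlam]
  · have h' : ¬ M.tau l k := fun h' => h (hsym l k h').1
    simp [contribution, h, h']

theorem contribution_swapAlloc (M : GMP N A) (π : N ≃ A) (i j : N) :
    M.contribution (swapAlloc π i j) i j = M.contribution π i j := by
  have hlam : M.lam (π j) (π i) ↔ M.lam (π i) (π j) := ⟨M.lamSymm _ _, M.lamSymm _ _⟩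
  simp [contribution, swapAlloc, hlam]

/-- With a symmetric player graph, a swap changes the potential by twice the total change in
utility of the two swapping players. -/
theorem Symm.phi_swapAlloc_sub_s2 {M : GMP N A} (hsym : M.Symm) (π : N ≃ A) {i j : N}
    (hij : i ≠ j) :
    M.phi (swapAlloc π i j) - M.phi π =
      2 * ((M.utility (swapAlloc π i j) i - M.utility π i) +
        (M.utility (swapAlloc π i j) j - M.utility π j)) := by
  have hfix : ∀ k, k ≠ i → k ≠ j → swapAlloc π i j k = π k := fun k hi hj => by
    simp [swapAlloc, Equiv.swap_apply_of_ne_of_ne hi hj]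
  have hv : ∑ k, (M.v k (swapAlloc π i j k) - M.v k (π k)) =
      (M.v i (swapAlloc π i j i) - M.v i (π i)) +
        (M.v j (swapAlloc π i j j) - M.v j (π j)) :=
    Fintype.sum_eq_add i j hij fun k hk => by rw [hfix k hk.1 hk.2, sub_self]
  have hc := sum_sum_eq_two_mul_of_symm_of_support
    (d := fun k l => M.contribution (swapAlloc π i j) k l - M.contribution π k l) hij
    (fun k l => by rw [hsym.contribution_comm _ k l, hsym.contribution_comm π k l])
    (fun k l hki hkj hli hlj => by simp [contribution, hfix k hki hkj, hfix l hli hlj])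
    (by simp [contribution_self]) (by simp [contribution_self])
    (by simp [contribution_swapAlloc])
  simp only [phi, utility_eq_add_sum_contribution, Finset.sum_add_distrib,
    Finset.sum_sub_distrib] at hv hc ⊢
  linarith

end GMP

/-- Every GMP instance with a symmetric player graph admits a
2-stable allocation. -/
theorem stmt2 {N A : Type*} [Fintype N] [Fintype A]
    (hcard : Fintype.card N = Fintype.card A)
    (M : GMP N A) (hsym : M.Symm) :
    ∃ π : N ≃ A, M.TwoStable π := by
  obtain ⟨e⟩ : Nonempty (N ≃ A) := Fintype.card_eq.mp hcard
  have : Nonempty (N ≃ A) := ⟨e⟩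
  obtain ⟨π, hπ⟩ := Finite.exists_max M.phi
  refine ⟨π, fun i j ⟨hij, hi, hj⟩ => ?_⟩
  linarith [hπ (swapAlloc π i j), hsym.phi_swapAlloc_sub_s2 π hij]
end

section
/- Let M be a graphical matching problem instance with uniform valuation whose player graph G is symmetric and unweighted (all edge weights equal 1). Then every improvement path consists of at most |τ| blocking-pair resolution steps: indeed, each blocking-pair resolution increases φ(π) = Σ_{i∈N} (v_i(π(i)) + u_i(π)) by at least 2, and for every allocation π, 2nc ≤ φ(π) ≤ 2nc + 2|τ|, where c is the common valuation value. -/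
open scoped Classical

variable {N A : Type*} [Fintype N] [Fintype A]

/-- If a symmetric matrix is supported on the rows and columns of `i ≠ j` and vanishes on the
`{i, j}` block, then its total sum is twice the sum of rows `i` and `j`. -/
theorem sum_sum_eq_two_mul_rows {N : Type*} [Fintype N] (D : N → N → ℝ) {i j : N}
    (hij : i ≠ j) (hD : ∀ a b, D a b = D b a)
    (h0 : ∀ a b, a ≠ i → a ≠ j → b ≠ i → b ≠ j → D a b = 0)
    (hii : D i i = 0) (hjj : D j j = 0) (hijD : D i j = 0) :
    ∑ a, ∑ b, D a b = 2 * (∑ b, D i b + ∑ b, D j b) := by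
  have key : ∀ a b, D a b = (if a = i then D i b else 0) + (if a = j then D j b else 0) +
      ((if b = i then D i a else 0) + (if b = j then D j a else 0)) := by
    intro a b
    have hjiD : D j i = 0 := by rw [hD, hijD]
    by_cases h1 : a = i <;> by_cases h2 : a = j <;> by_cases h3 : b = i <;>
      by_cases h4 : b = j <;> grind
  rw [Finset.sum_congr rfl fun a _ => Finset.sum_congr rfl fun b _ => key a b]
  simp only [Finset.sum_add_distrib]
  rw [Finset.sum_comm (f := fun a b => if a = i then D i b else 0),
    Finset.sum_comm (f := fun a b => if a = j then D j b else 0)]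
  simp only [Finset.sum_ite_eq', Finset.mem_univ, if_true]
  ring

/-- The number of in-neighbours of `i` whose items are adjacent to the item of `i`. -/
noncomputable def GMP.neighborCount (M : GMP N A) (π : N ≃ A) (i : N) : ℕ :=
  (Finset.univ.filter (fun j => M.tau j i ∧ M.lam (π j) (π i))).card

theorem GMP.utility_eq_add_neighborCount (M : GMP N A) {c : ℝ} (hv : ∀ i a, M.v i a = c)
    (hw : ∀ i j, M.tau i j → M.w i j = 1) (π : N ≃ A) (i : N) :
    M.utility π i = c + M.neighborCount π i := by
  rw [GMP.utility, GMP.neighborCount, hv, Finset.card_eq_sum_ones, Nat.cast_sum]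
  congr 1
  refine Finset.sum_congr rfl fun j hj => ?_
  rw [hw j i (Finset.mem_filter.1 hj).2.1, Nat.cast_one]

theorem GMP.phi_eq_add_sum_neighborCount (M : GMP N A) {c : ℝ} (hv : ∀ i a, M.v i a = c)
    (hw : ∀ i j, M.tau i j → M.w i j = 1) (π : N ≃ A) :
    M.phi π = 2 * (Fintype.card N : ℝ) * c + ∑ i, (M.neighborCount π i : ℝ) := by
  simp only [GMP.phi, hv, M.utility_eq_add_neighborCount hv hw, Finset.sum_add_distrib,
    Finset.sum_const, Finset.card_univ, nsmul_eq_mul]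
  ring

theorem GMP.sum_neighborCount_le (M : GMP N A) (π : N ≃ A) :
    ∑ i, M.neighborCount π i ≤
      (Finset.univ.filter (fun p : N × N => M.tau p.1 p.2)).card := by
  simp only [GMP.neighborCount, Finset.card_filter]
  rw [Fintype.sum_prod_type_right]
  refine Finset.sum_le_sum fun i _ => Finset.sum_le_sum fun j _ => ?_
  split_ifs <;> simp_all

/-- Swapping the items of `i` and `j` changes the total neighbour count by twice the change
experienced by `i` and `j`. -/
theorem GMP.sum_neighborCount_swapAlloc (M : GMP N A) (hsym : M.Symm) (π : N ≃ A) {i j : N}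
    (hij : i ≠ j) :
    ∑ a, (M.neighborCount (swapAlloc π i j) a : ℝ) - ∑ a, (M.neighborCount π a : ℝ) =
      2 * ((M.neighborCount (swapAlloc π i j) i - M.neighborCount π i : ℝ) +
        (M.neighborCount (swapAlloc π i j) j - M.neighborCount π j)) := by
  have htau : ∀ a b, M.tau a b ↔ M.tau b a := fun a b =>
    ⟨fun h => (hsym a b h).1, fun h => (hsym b a h).1⟩
  have hlam : ∀ a b, M.lam a b ↔ M.lam b a := fun a b => ⟨M.lamSymm a b, M.lamSymm b a⟩
  have hi : swapAlloc π i j i = π j := by simp [swapAlloc]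
  have hj : swapAlloc π i j j = π i := by simp [swapAlloc]
  have hk : ∀ k, k ≠ i → k ≠ j → swapAlloc π i j k = π k := fun k h₁ h₂ => by
    simp [swapAlloc, Equiv.swap_apply_of_ne_of_ne h₁ h₂]
  have h := sum_sum_eq_two_mul_rows
    (fun a b => (if M.tau b a ∧ M.lam (swapAlloc π i j b) (swapAlloc π i j a) then (1 : ℝ) else 0) -
      if M.tau b a ∧ M.lam (π b) (π a) then 1 else 0) hij
    (fun a b => by
      simp only [htau b a, hlam (π b), hlam (swapAlloc π i j b)])
    (fun a b h₁ h₂ h₃ h₄ => by simp only [hk a h₁ h₂, hk b h₃ h₄, sub_self])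
    (by simp [M.noSelf]) (by simp [M.noSelf])
    (by simp only [hi, hj, hlam (π i) (π j), sub_self])
  simpa only [GMP.neighborCount, Finset.card_filter, Nat.cast_sum, Nat.cast_ite, Nat.cast_one,
    Nat.cast_zero, Finset.sum_sub_distrib] using h

theorem GMP.BlockingPair.phi_add_two_le {M : GMP N A} (hsym : M.Symm) {c : ℝ}
    (hv : ∀ i a, M.v i a = c) (hw : ∀ i j, M.tau i j → M.w i j = 1) {π : N ≃ A} {i j : N}
    (h : M.BlockingPair π i j) : M.phi π + 2 ≤ M.phi (swapAlloc π i j) := by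
  obtain ⟨hij, hi, hj⟩ := h
  simp only [M.utility_eq_add_neighborCount hv hw, add_lt_add_iff_left, Nat.cast_lt] at hi hj
  have hi' : (M.neighborCount π i : ℝ) + 1 ≤ M.neighborCount (swapAlloc π i j) i := by
    exact_mod_cast hi
  have hj' : (M.neighborCount π j : ℝ) + 1 ≤ M.neighborCount (swapAlloc π i j) j := by
    exact_mod_cast hj
  have hsum := M.sum_neighborCount_swapAlloc hsym π hij
  rw [M.phi_eq_add_sum_neighborCount hv hw, M.phi_eq_add_sum_neighborCount hv hw]
  linarith

/-- In a symmetric, unweighted GMP instance with uniform valuation `c`: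
every blocking-pair resolution increases `φ` by at least 2; `φ` always lies between
`2nc` and `2nc + 2|τ|`; and hence every improvement path has at most `|τ|` steps. -/
theorem stmt3 {N A : Type*} [Fintype N] [Fintype A] (M : GMP N A)
    (hsym : M.Symm) (c : ℝ) (hc : 0 ≤ c) (hv : ∀ i a, M.v i a = c)
    (hw : ∀ i j, M.tau i j → M.w i j = 1) :
    (∀ (π : N ≃ A) (i j : N), M.BlockingPair π i j →
        M.phi π + 2 ≤ M.phi (swapAlloc π i j)) ∧
    (∀ π : N ≃ A,
        2 * (Fintype.card N : ℝ) * c ≤ M.phi π ∧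
        M.phi π ≤ 2 * (Fintype.card N : ℝ) * c +
          2 * ((Finset.univ.filter (fun p : N × N => M.tau p.1 p.2)).card : ℝ)) ∧
    (∀ (f : ℕ → N ≃ A) (L : ℕ),
        (∀ k < L, ∃ i j : N,
          M.BlockingPair (f k) i j ∧ f (k + 1) = swapAlloc (f k) i j) →
        L ≤ (Finset.univ.filter (fun p : N × N => M.tau p.1 p.2)).card) := by
  have hstep : ∀ (π : N ≃ A) (i j : N), M.BlockingPair π i j →
      M.phi π + 2 ≤ M.phi (swapAlloc π i j) := fun _ _ _ h => h.phi_add_two_le hsym hv hw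
  have hbound : ∀ π : N ≃ A,
      2 * (Fintype.card N : ℝ) * c ≤ M.phi π ∧
      M.phi π ≤ 2 * (Fintype.card N : ℝ) * c +
        2 * ((Finset.univ.filter (fun p : N × N => M.tau p.1 p.2)).card : ℝ) := by
    intro π
    have h0 : (0 : ℝ) ≤ ∑ i, (M.neighborCount π i : ℝ) := by positivity
    have h1 : ∑ i, (M.neighborCount π i : ℝ) ≤
        ((Finset.univ.filter (fun p : N × N => M.tau p.1 p.2)).card : ℝ) := by
      exact_mod_cast M.sum_neighborCount_le π
    rw [M.phi_eq_add_sum_neighborCount hv hw]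
    constructor <;> linarith
  refine ⟨hstep, hbound, fun f L hf => ?_⟩
  have hpath : ∀ k ≤ L, M.phi (f 0) + 2 * (k : ℝ) ≤ M.phi (f k) := by
    intro k
    induction k with
    | zero => simp
    | succ k ih =>
      intro hk
      obtain ⟨i, j, hb, he⟩ := hf k hk
      have := hstep _ i j hb
      have := ih (by omega)
      rw [he]
      push_cast
      linarith
  have h2 := hpath L le_rfl
  have h3 := (hbound (f 0)).1
  have h4 := (hbound (f L)).2
  have h5 : (L : ℝ) ≤ ((Finset.univ.filter (fun p : N × N => M.tau p.1 p.2)).card : ℝ) := by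
    linarith
  exact_mod_cast h5
end

section
/- There exists a graphical matching problem instance with no 2-stable allocation, even with uniform valuation and an unweighted player graph. Concretely: let N = {1,...,6}, let the player graph be the directed cycle with edges (i, i+1) for 1 ≤ i ≤ 5 and (6,1), all with weight c for some positive constant c; let v_i(a) = 0 for all i and a; and let the item graph on items {A,B,C,D,E,F} consist of two disjoint triangles {A,B,C} and {D,E,F}. Then no allocation of this instance is 2-stable. -/
open scoped Classical

variable {N A : Type*} [Fintype N] [Fintype A]

/-- The instance of Example 2: six players on a directed cycle with edge weight `c`,
zero valuations, and an item graph consisting of two disjoint triangles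
(items `{0,1,2}` and `{3,4,5}`). -/
def exampleGMP (c : ℝ) : GMP (Fin 6) (Fin 6) where
  tau i j := j = i + 1
  w _ _ := c
  noSelf := by decide
  lam a b := a ≠ b ∧ (a.val < 3 ↔ b.val < 3)
  lamSymm := by decide
  lamIrrefl := by decide
  v _ _ := 0
  vNonneg _ _ := le_refl 0

/-- In the example, a player gains `c` exactly when its predecessor holds an item of the
same triangle. -/
theorem exampleGMP_utility (c : ℝ) (π : Fin 6 ≃ Fin 6) (i : Fin 6) :
    (exampleGMP c).utility π i = if ((π (i - 1)).val < 3 ↔ (π i).val < 3) then c else 0 := by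
  have hne : π (i - 1) ≠ π i := fun h => by simpa using π.injective h
  have hpred : ∀ j : Fin 6, i = j + 1 ↔ j = i - 1 := fun j =>
    eq_comm.trans eq_sub_iff_add_eq.symm
  simp only [GMP.utility, exampleGMP, zero_add, hpred, Finset.sum_filter, ite_and,
    Finset.sum_ite_eq', Finset.mem_univ, if_true, if_pos hne]

/-- Two non-adjacent players holding items of different triangles, each with a predecessor
holding an item of the other triangle, block the allocation. -/
theorem exampleGMP_blockingPair {c : ℝ} (hc : 0 < c) (π : Fin 6 ≃ Fin 6) {i j : Fin 6}
    (hij : i ≠ j) (hij' : i - 1 ≠ j) (hji' : j - 1 ≠ i)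
    (hi : ¬ ((π (i - 1)).val < 3 ↔ (π i).val < 3))
    (hj : ¬ ((π (j - 1)).val < 3 ↔ (π j).val < 3))
    (h : ¬ ((π i).val < 3 ↔ (π j).val < 3)) :
    (exampleGMP c).BlockingPair π i j := by
  have hi₁ : i - 1 ≠ i := by simp
  have hj₁ : j - 1 ≠ j := by simp
  refine ⟨hij, ?_, ?_⟩
  · rw [exampleGMP_utility, exampleGMP_utility, if_neg hi, if_pos]
    · exact hc
    · simp only [swapAlloc, Equiv.trans_apply, Equiv.swap_apply_left,
        Equiv.swap_apply_of_ne_of_ne, ne_eq, hi₁, hij', not_false_eq_true]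
      tauto
  · rw [exampleGMP_utility, exampleGMP_utility, if_neg hj, if_pos]
    · exact hc
    · simp only [swapAlloc, Equiv.trans_apply, Equiv.swap_apply_right,
        Equiv.swap_apply_of_ne_of_ne, ne_eq, hji', hj₁, not_false_eq_true]
      tauto

/-- Every balanced two-colouring of a 6-cycle has two non-adjacent vertices of different
colours whose predecessors have the opposite colours. -/
theorem exists_nonadjacent_alternations (b : Fin 6 → Bool)
    (hb : (Finset.univ.filter fun i => b i = true).card = 3) :
    ∃ i j : Fin 6, i ≠ j ∧ i - 1 ≠ j ∧ j - 1 ≠ i ∧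
      b (i - 1) ≠ b i ∧ b (j - 1) ≠ b j ∧ b i ≠ b j := by
  revert b
  decide +kernel

/-- the above instance (for any positive weight `c`) has no
2-stable allocation. -/
theorem stmt4 (c : ℝ) (hc : 0 < c) (π : Fin 6 ≃ Fin 6) :
    ¬ (exampleGMP c).TwoStable π := by
  intro hπ
  have hcard : (Finset.univ.filter fun i => decide ((π i).val < 3) = true).card = 3 := by
    have h : (Finset.univ.filter fun a : Fin 6 => a.val < 3).card = 3 := by decide
    exact (Finset.card_equiv π (by simp)).trans h
  obtain ⟨i, j, hij, hij', hji', hi, hj, h⟩ :=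
    exists_nonadjacent_alternations (fun i => decide ((π i).val < 3)) hcard
  simp only [ne_eq, decide_eq_decide] at hi hj h
  exact hπ i j (exampleGMP_blockingPair hc π hij hij' hji' hi hj h)
end

section
/- Let Q = (V, E, (z_e)_{e∈E}) be a finite graph with nonempty edge set and nonnegative edge weights, and construct the GMP instance M(Q) as follows: the player set is N = { v_blue, v_red : v ∈ V } (so |N| = 2|V|); for each edge (u,v) ∈ E, the symmetric player-graph edges (u_blue, v_blue) and (u_red, v_red) have weight z_{(u,v)}; for each v ∈ V, the symmetric player-graph edge (v_blue, v_red) has weight w_max = |N|² · (max_{e∈E} z_e − min_{e∈E} z_e); the item graph is the complete bipartite graph with parts A₁ and A₂, each of size |V|; and all valuations are zero. Then for every cut (V₁, V̄₁) of V, every allocation π with π(v_blue) ∈ A₁ and π(v_red) ∈ A₂ for all v ∈ V₁, and π(v_blue) ∈ A₂ and π(v_red) ∈ A₁ for all v ∈ V̄₁, satisfies SW(π) = 4 · cutWeight(V₁, V̄₁) + 2|V| · w_max, where cutWeight(V₁, V̄₁) = Σ_{(u,v)∈E, |{u,v}∩V₁|=1} z_{(u,v)}. -/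
open scoped Classical

variable {N A : Type*} [Fintype N] [Fintype A]

/-- The GMP instance constructed from a weighted graph `Q = (V, E, z)` in the
PLS-hardness reduction: players are `V × Bool` (`false` = blue, `true` = red);
for each edge `(u,v) ∈ E` there are symmetric player edges between the blue copies
and between the red copies of weight `z (u,v)`; for each vertex `v` there is a
symmetric player edge between `v_blue` and `v_red` of weight
`w_max = |N|² (max_e z_e − min_e z_e)`; the item graph is the complete bipartite
graph whose parts are `V × {false}` and `V × {true}`; all valuations are zero. -/
noncomputable def maxCutGMP {V : Type*} [Fintype V] [DecidableEq V]
    (E : Finset (V × V)) (hE : E.Nonempty) (hirr : ∀ p ∈ E, p.1 ≠ p.2)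
    (z : V × V → ℝ) : GMP (V × Bool) (V × Bool) where
  tau p q := (p.2 = q.2 ∧ ((p.1, q.1) ∈ E ∨ (q.1, p.1) ∈ E)) ∨ (p.1 = q.1 ∧ p.2 ≠ q.2)
  w p q :=
    if p.1 = q.1 then ((Fintype.card (V × Bool) : ℝ)) ^ 2 * (E.sup' hE z - E.inf' hE z)
    else if (p.1, q.1) ∈ E then z (p.1, q.1) else z (q.1, p.1)
  noSelf := by
    rintro ⟨a, c⟩ (⟨-, h | h⟩ | ⟨-, h⟩)
    · exact hirr _ h rfl
    · exact hirr _ h rfl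
    · exact h rfl
  lam p q := p.2 ≠ q.2
  lamSymm _ _ h := Ne.symm h
  lamIrrefl _ h := h rfl
  v _ _ := 0
  vNonneg _ _ := le_refl 0

/-- In the allocation induced by the cut `V₁`, players `(v, c)` and `(u, b)` receive adjacent items
exactly when the colours differ or the cut separates `u` and `v`, but not both. -/
theorem maxCutGMP_item_ne_iff {V : Type*} (V₁ : Finset V) (π : (V × Bool) ≃ (V × Bool))
    (hπ : ∀ v : V,
      (v ∈ V₁ → (π (v, false)).2 = false ∧ (π (v, true)).2 = true) ∧
      (v ∉ V₁ → (π (v, false)).2 = true ∧ (π (v, true)).2 = false))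
    (v u : V) (c b : Bool) :
    (π (v, c)).2 ≠ (π (u, b)).2 ↔ (c = b ↔ ¬ (v ∈ V₁ ↔ u ∈ V₁)) := by
  have hv := hπ v
  have hu := hπ u
  by_cases h1 : v ∈ V₁ <;> by_cases h2 : u ∈ V₁ <;> cases c <;> cases b <;> simp_all

/-- The total contribution to the social welfare of the colour copies of `v` and `u`. -/
theorem maxCutGMP_sum_copies {V : Type*} [Fintype V] [DecidableEq V]
    (E : Finset (V × V)) (hE : E.Nonempty)
    (hirr : ∀ p ∈ E, p.1 ≠ p.2) (hanti : ∀ p ∈ E, (p.2, p.1) ∉ E)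
    (z : V × V → ℝ)
    (V₁ : Finset V) (π : (V × Bool) ≃ (V × Bool))
    (hπ : ∀ v : V,
      (v ∈ V₁ → (π (v, false)).2 = false ∧ (π (v, true)).2 = true) ∧
      (v ∉ V₁ → (π (v, false)).2 = true ∧ (π (v, true)).2 = false))
    (u v : V) :
    (∑ b : Bool, ∑ c : Bool,
      if (maxCutGMP E hE hirr z).tau (v, c) (u, b) ∧
          (maxCutGMP E hE hirr z).lam (π (v, c)) (π (u, b)) then
        (maxCutGMP E hE hirr z).w (v, c) (u, b) else 0) =
      (if u = v then
        2 * (((Fintype.card (V × Bool) : ℝ)) ^ 2 * (E.sup' hE z - E.inf' hE z)) else 0) +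
      2 * (if (u, v) ∈ E ∧ ((u ∈ V₁ ∧ v ∉ V₁) ∨ (u ∉ V₁ ∧ v ∈ V₁)) then z (u, v) else 0) +
      2 * (if (v, u) ∈ E ∧ ((v ∈ V₁ ∧ u ∉ V₁) ∨ (v ∉ V₁ ∧ u ∈ V₁)) then z (v, u) else 0) := by
  simp only [maxCutGMP, maxCutGMP_item_ne_iff V₁ π hπ]
  generalize ((Fintype.card (V × Bool) : ℝ)) ^ 2 * (E.sup' hE z - E.inf' hE z) = W
  by_cases huv : u = v
  · subst huv
    have h : (u, u) ∉ E := fun h => hirr _ h rfl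
    simp [h, two_mul]
  · have h1 := hanti (u, v)
    by_cases h2 : (u, v) ∈ E <;> by_cases h3 : (v, u) ∈ E <;>
      by_cases h4 : u ∈ V₁ <;> by_cases h5 : v ∈ V₁ <;>
      simp [h2, h3, h4, h5, huv, Ne.symm huv, two_mul] at h1 ⊢

/-- for every cut `(V₁, V̄₁)` of `V`, every allocation `π` placing the
blue copy of each `v ∈ V₁` in part `A₁` and its red copy in part `A₂` (and vice versa
for `v ∉ V₁`) has social welfare `4 · cutWeight(V₁, V̄₁) + 2|V| · w_max`. -/
theorem stmt5 {V : Type*} [Fintype V] [DecidableEq V]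
    (E : Finset (V × V)) (hE : E.Nonempty)
    (hirr : ∀ p ∈ E, p.1 ≠ p.2) (hanti : ∀ p ∈ E, (p.2, p.1) ∉ E)
    (z : V × V → ℝ) (hz : ∀ p ∈ E, 0 ≤ z p)
    (V₁ : Finset V) (π : (V × Bool) ≃ (V × Bool))
    (hπ : ∀ v : V,
      (v ∈ V₁ → (π (v, false)).2 = false ∧ (π (v, true)).2 = true) ∧
      (v ∉ V₁ → (π (v, false)).2 = true ∧ (π (v, true)).2 = false)) :
    (maxCutGMP E hE hirr z).SW π =
      4 * ∑ p ∈ E.filter (fun p => (p.1 ∈ V₁ ∧ p.2 ∉ V₁) ∨ (p.1 ∉ V₁ ∧ p.2 ∈ V₁)), z p +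
      2 * (Fintype.card V : ℝ) *
        (((Fintype.card (V × Bool) : ℝ)) ^ 2 * (E.sup' hE z - E.inf' hE z)) := by
  have hcut : ∑ p ∈ E.filter (fun p => (p.1 ∈ V₁ ∧ p.2 ∉ V₁) ∨ (p.1 ∉ V₁ ∧ p.2 ∈ V₁)), z p =
      ∑ u : V, ∑ v : V,
        if (u, v) ∈ E ∧ ((u ∈ V₁ ∧ v ∉ V₁) ∨ (u ∉ V₁ ∧ v ∈ V₁)) then z (u, v) else 0 := by
    rw [← Fintype.sum_prod_type' (fun u v =>
      if (u, v) ∈ E ∧ ((u ∈ V₁ ∧ v ∉ V₁) ∨ (u ∉ V₁ ∧ v ∈ V₁)) then z (u, v) else 0),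
      ← Finset.sum_filter]
    congr 1
    ext p
    simp
  have hv : ∀ i a, (maxCutGMP E hE hirr z).v i a = 0 := fun _ _ => rfl
  have hsum : (maxCutGMP E hE hirr z).SW π = ∑ u : V, ∑ v : V, ∑ b : Bool, ∑ c : Bool,
      if (maxCutGMP E hE hirr z).tau (v, c) (u, b) ∧
          (maxCutGMP E hE hirr z).lam (π (v, c)) (π (u, b)) then
        (maxCutGMP E hE hirr z).w (v, c) (u, b) else 0 := by
    simp only [GMP.SW, GMP.utility, hv, zero_add, Finset.sum_filter, Fintype.sum_prod_type]
    exact Finset.sum_congr rfl fun u _ => Finset.sum_comm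
  rw [hsum, hcut]
  simp only [maxCutGMP_sum_copies E hE hirr hanti z V₁ π hπ, Finset.sum_add_distrib,
    ← Finset.mul_sum, Finset.sum_ite_eq, Finset.mem_univ, if_true, Finset.sum_const,
    Finset.card_univ, nsmul_eq_mul]
  rw [Finset.sum_comm (f := fun u v =>
    if (v, u) ∈ E ∧ ((v ∈ V₁ ∧ u ∉ V₁) ∨ (v ∉ V₁ ∧ u ∈ V₁)) then z (v, u) else 0)]
  ring
end

section
/- Let M be a graphical matching problem instance with uniform valuation whose player graph G is symmetric and in which every vertex of G has degree at most two. Then there exists a function P from the set of allocations to the integers such that 0 ≤ P(π) ≤ 6n² for every allocation π, and P(π') > P(π) whenever π →_{i,j} π' is a blocking-pair resolution. Consequently, every improvement path in M has at most 6n² resolution steps. -/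
open scoped Classical

variable {N A : Type*} [Fintype N] [Fintype A]

/-- The pairs of players `(j, i)` related by `tau`. -/
noncomputable def GMP.arcs (M : GMP N A) : Finset (N × N) :=
  Finset.univ.filter fun p => M.tau p.1 p.2

/-- The number of arcs whose weight is at most `x` in absolute value. -/
noncomputable def GMP.absRank (M : GMP N A) (x : ℝ) : ℤ :=
  ((M.arcs.filter fun p => |M.w p.1 p.2| ≤ x).card : ℤ)

/-- The integer weight of an arc: the rank of its absolute weight, with the sign of the weight. -/
noncomputable def GMP.rankWeight (M : GMP N A) (j i : N) : ℤ :=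
  if 0 < M.w j i then M.absRank |M.w j i|
  else if M.w j i < 0 then -M.absRank |M.w j i| else 0

/-- The contribution of player `j` to the utility of player `i`, with integer weights. -/
noncomputable def GMP.rankTerm (M : GMP N A) (π : N ≃ A) (j i : N) : ℤ :=
  if M.tau j i ∧ M.lam (π j) (π i) then M.rankWeight j i else 0

/-- The potential: the total integer weight of active arcs, shifted to be nonnegative. -/
noncomputable def GMP.potential (M : GMP N A) (π : N ≃ A) : ℤ :=
  ∑ i, ∑ j, (M.rankTerm π j i + if M.tau j i then max 0 (-M.rankWeight j i) else 0)

lemma GMP.absRank_nonneg (M : GMP N A) (x : ℝ) : 0 ≤ M.absRank x := by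
  unfold GMP.absRank; positivity

lemma GMP.absRank_lt (M : GMP N A) {j i : N} (hji : M.tau j i) {x : ℝ} (h : x < |M.w j i|) :
    M.absRank x < M.absRank |M.w j i| := by
  unfold GMP.absRank
  refine Int.ofNat_lt.mpr (Finset.card_lt_card ?_)
  refine Finset.ssubset_iff_of_subset
    (Finset.monotone_filter_right _ fun p _ hp => le_trans hp h.le) |>.mpr
      ⟨(j, i), ?_, ?_⟩
  · simp [GMP.arcs, hji]
  · simp [h]

lemma GMP.absRank_pos (M : GMP N A) {j i : N} (hji : M.tau j i) : 0 < M.absRank |M.w j i| := by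
  unfold GMP.absRank
  refine Int.natCast_pos.mpr (Finset.card_pos.mpr ⟨(j, i), ?_⟩)
  simp [GMP.arcs, hji]

lemma GMP.card_arcs_le (M : GMP N A)
    (hdeg : ∀ i : N, (Finset.univ.filter (fun j => M.tau j i)).card ≤ 2) :
    (M.arcs.card : ℤ) ≤ 2 * Fintype.card N := by
  have h : M.arcs.card = ∑ i, (Finset.univ.filter (fun j => M.tau j i)).card := by
    simp only [GMP.arcs, Finset.card_filter]
    rw [Fintype.sum_prod_type_right]
  have h2 : M.arcs.card ≤ ∑ _i : N, 2 := h ▸ Finset.sum_le_sum fun i _ => hdeg i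
  simp only [Finset.sum_const, Finset.card_univ, smul_eq_mul] at h2
  omega

lemma GMP.absRank_le_card_arcs (M : GMP N A) (x : ℝ) : M.absRank x ≤ M.arcs.card := by
  unfold GMP.absRank
  exact_mod_cast Finset.card_filter_le _ _

lemma GMP.abs_rankWeight_le (M : GMP N A) (j i : N) : |M.rankWeight j i| ≤ M.arcs.card := by
  have h0 := M.absRank_nonneg |M.w j i|
  have h1 := M.absRank_le_card_arcs |M.w j i|
  unfold GMP.rankWeight
  split_ifs <;> simp only [abs_neg, abs_zero, abs_of_nonneg h0] <;> omega

lemma GMP.potential_nonneg (M : GMP N A) (π : N ≃ A) : 0 ≤ M.potential π := by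
  refine Finset.sum_nonneg fun i _ => Finset.sum_nonneg fun j _ => ?_
  unfold GMP.rankTerm
  split_ifs <;> first | omega | simp_all

lemma GMP.potential_le (M : GMP N A) (π : N ≃ A) :
    M.potential π ≤ (M.arcs.card : ℤ) ^ 2 := by
  have hterm : ∀ i j, (M.rankTerm π j i + if M.tau j i then max 0 (-M.rankWeight j i) else 0) ≤
      if M.tau j i then (M.arcs.card : ℤ) else 0 := by
    intro i j
    have h := abs_le.mp (M.abs_rankWeight_le j i)
    unfold GMP.rankTerm
    split_ifs <;> first | omega | simp_all
  calc M.potential π ≤ ∑ i, ∑ j, if M.tau j i then (M.arcs.card : ℤ) else 0 :=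
        Finset.sum_le_sum fun i _ => Finset.sum_le_sum fun j _ => hterm i j
    _ = ∑ p ∈ M.arcs, (M.arcs.card : ℤ) := by
        rw [GMP.arcs, Finset.sum_filter, Fintype.sum_prod_type_right]
    _ = (M.arcs.card : ℤ) ^ 2 := by simp [sq]

/-- The integer weights order the signed sums of at most two arc weights at a common endpoint
in the same way as the original weights. -/
lemma GMP.sum_rankWeight_pos (M : GMP N A) (i : N)
    (hdeg : (Finset.univ.filter (fun j => M.tau j i)).card ≤ 2) (e : N → ℤ)
    (he : ∀ j, e j = -1 ∨ e j = 0 ∨ e j = 1)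
    (h : 0 < ∑ j ∈ Finset.univ.filter (fun j => M.tau j i), (e j : ℝ) * M.w j i) :
    0 < ∑ j ∈ Finset.univ.filter (fun j => M.tau j i), e j * M.rankWeight j i := by
  generalize hs : Finset.univ.filter (fun j => M.tau j i) = s at *
  have hτ : ∀ j ∈ s, M.tau j i := fun j hj => by subst hs; simpa using hj
  have hsgn : ∀ j ∈ s, (0 < M.w j i ∧ M.rankWeight j i = M.absRank |M.w j i| ∧
        |M.w j i| = M.w j i) ∨
      (M.w j i < 0 ∧ M.rankWeight j i = -M.absRank |M.w j i| ∧ |M.w j i| = -M.w j i) ∨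
      (M.w j i = 0 ∧ M.rankWeight j i = 0) := by
    intro j hj
    rcases lt_trichotomy (M.w j i) 0 with h | h | h
    · exact Or.inr (Or.inl ⟨h, by simp [GMP.rankWeight, h, not_lt.mpr h.le],
        abs_of_neg h⟩)
    · exact Or.inr (Or.inr ⟨h, by simp [GMP.rankWeight, h]⟩)
    · exact Or.inl ⟨h, by simp [GMP.rankWeight, h], abs_of_pos h⟩
  obtain hc | hc | hc : s.card = 0 ∨ s.card = 1 ∨ s.card = 2 := by omega
  · rw [Finset.card_eq_zero.mp hc] at h
    simp at h
  · obtain ⟨a, rfl⟩ := Finset.card_eq_one.mp hc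
    have hp := M.absRank_pos (hτ a (by simp))
    simp only [Finset.sum_singleton] at h ⊢
    rcases he a with ha | ha | ha <;> rw [ha] at h ⊢ <;> push_cast at h <;>
      rcases hsgn a (by simp) with ⟨h1, h2, h3⟩ | ⟨h1, h2, h3⟩ | ⟨h1, h2⟩ <;>
      first | (exfalso; linarith) | linarith
  · obtain ⟨a, b, hab, rfl⟩ := Finset.card_eq_two.mp hc
    have hpa := M.absRank_pos (hτ a (by simp))
    have hpb := M.absRank_pos (hτ b (by simp))
    have hlt : |M.w a i| < |M.w b i| → M.absRank |M.w a i| < M.absRank |M.w b i| :=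
      M.absRank_lt (hτ b (by simp))
    have hgt : |M.w b i| < |M.w a i| → M.absRank |M.w b i| < M.absRank |M.w a i| :=
      M.absRank_lt (hτ a (by simp))
    rw [Finset.sum_pair hab] at h ⊢
    rcases he a with ha | ha | ha <;> rcases he b with hb | hb | hb <;>
      rw [ha, hb] at h ⊢ <;> push_cast at h <;>
      rcases hsgn a (by simp) with ⟨h1, h2, h3⟩ | ⟨h1, h2, h3⟩ | ⟨h1, h2⟩ <;>
      rcases hsgn b (by simp) with ⟨h4, h5, h6⟩ | ⟨h4, h5, h6⟩ | ⟨h4, h5⟩ <;>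
      first
      | (exfalso; linarith)
      | linarith
      | linarith [hlt (by linarith)]
      | linarith [hgt (by linarith)]

lemma GMP.sum_rankTerm_lt (M : GMP N A) (c : ℝ) (hv : ∀ i a, M.v i a = c) (i : N)
    (hdeg : (Finset.univ.filter (fun j => M.tau j i)).card ≤ 2) (π π' : N ≃ A)
    (h : M.utility π i < M.utility π' i) :
    ∑ j, M.rankTerm π j i < ∑ j, M.rankTerm π' j i := by
  let act (ρ : N ≃ A) (j : N) : ℤ := if M.lam (ρ j) (ρ i) then 1 else 0
  have hU : ∀ ρ : N ≃ A, M.utility ρ i = c +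
      ∑ j ∈ Finset.univ.filter (fun j => M.tau j i), (act ρ j : ℝ) * M.w j i := by
    intro ρ
    rw [GMP.utility, hv, ← Finset.filter_filter, Finset.sum_filter]
    congr 1
    refine Finset.sum_congr rfl fun j _ => ?_
    by_cases hl : M.lam (ρ j) (ρ i) <;> simp [act, hl]
  have hR : ∀ ρ : N ≃ A, ∑ j, M.rankTerm ρ j i =
      ∑ j ∈ Finset.univ.filter (fun j => M.tau j i), act ρ j * M.rankWeight j i := by
    intro ρ
    rw [Finset.sum_filter]
    refine Finset.sum_congr rfl fun j _ => ?_
    by_cases ht : M.tau j i <;> by_cases hl : M.lam (ρ j) (ρ i) <;>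
      simp [GMP.rankTerm, act, hl, ht]
  have key := M.sum_rankWeight_pos i hdeg (fun j => act π' j - act π j)
    (fun j => by dsimp only [act]; split_ifs <;> simp)
    (by
      rw [hU, hU] at h
      push_cast
      simp only [sub_mul, Finset.sum_sub_distrib]
      linarith)
  rw [hR, hR]
  simp only [sub_mul, Finset.sum_sub_distrib] at key
  linarith

lemma sum_sum_eq_of_support_pair {N : Type*} [Fintype N] (d : N → N → ℤ) (i j : N) (hij : i ≠ j)
    (hsymm : ∀ k l, d k l = d l k) (hii : d i i = 0) (hjj : d j j = 0) (hd : d i j = 0)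
    (h0 : ∀ k l, k ≠ i → k ≠ j → l ≠ i → l ≠ j → d k l = 0) :
    ∑ k, ∑ l, d l k = 2 * (∑ l, d l i + ∑ l, d l j) := by
  have hpt : ∀ k l, d l k = (if k = i then d l i else 0) + (if k = j then d l j else 0) +
      ((if l = i then d k i else 0) + (if l = j then d k j else 0)) := by
    intro k l
    have hji := hsymm i j
    by_cases h1 : k = i <;> by_cases h2 : k = j <;> by_cases h3 : l = i <;>
      by_cases h4 : l = j <;> grind
  have hcol : ∀ m : N, ∑ k, ∑ l, (if k = m then d l m else 0) = ∑ l, d l m := by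
    intro m
    rw [Finset.sum_comm]
    simp
  have hrow : ∀ m : N, ∑ k, ∑ l, (if l = m then d k m else 0) = ∑ l, d l m := by
    intro m
    simp
  rw [Finset.sum_congr rfl fun k _ => Finset.sum_congr rfl fun l _ => hpt k l]
  simp only [Finset.sum_add_distrib, hcol, hrow]
  ring

lemma GMP.rankWeight_comm (M : GMP N A) (hsym : M.Symm) {j i : N} (h : M.tau j i) :
    M.rankWeight j i = M.rankWeight i j := by
  simp only [GMP.rankWeight, (hsym j i h).2]

lemma GMP.rankTerm_comm (M : GMP N A) (hsym : M.Symm) (π : N ≃ A) (j i : N) :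
    M.rankTerm π j i = M.rankTerm π i j := by
  have hiff : (M.tau j i ∧ M.lam (π j) (π i)) ↔ (M.tau i j ∧ M.lam (π i) (π j)) :=
    ⟨fun h => ⟨(hsym _ _ h.1).1, M.lamSymm _ _ h.2⟩,
      fun h => ⟨(hsym _ _ h.1).1, M.lamSymm _ _ h.2⟩⟩
  unfold GMP.rankTerm
  by_cases h : M.tau j i ∧ M.lam (π j) (π i)
  · rw [if_pos h, if_pos (hiff.mp h), M.rankWeight_comm hsym h.1]
  · rw [if_neg h, if_neg (mt hiff.mpr h)]

lemma GMP.rankTerm_self (M : GMP N A) (π : N ≃ A) (i : N) : M.rankTerm π i i = 0 :=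
  if_neg fun h => M.noSelf i h.1

lemma GMP.rankTerm_swapAlloc (M : GMP N A) (π : N ≃ A) (i j : N) :
    M.rankTerm (swapAlloc π i j) i j = M.rankTerm π i j := by
  have hiff : M.lam (π j) (π i) ↔ M.lam (π i) (π j) := ⟨M.lamSymm _ _, M.lamSymm _ _⟩
  simp [GMP.rankTerm, swapAlloc, hiff]

lemma GMP.potential_lt_of_blockingPair (M : GMP N A) (hsym : M.Symm) (c : ℝ)
    (hv : ∀ i a, M.v i a = c)
    (hdeg : ∀ i : N, (Finset.univ.filter (fun j => M.tau j i)).card ≤ 2)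
    {π : N ≃ A} {i j : N} (h : M.BlockingPair π i j) :
    M.potential π < M.potential (swapAlloc π i j) := by
  obtain ⟨hij, hi, hj⟩ := h
  have hi' := M.sum_rankTerm_lt c hv i (hdeg i) _ _ hi
  have hj' := M.sum_rankTerm_lt c hv j (hdeg j) _ _ hj
  have key := sum_sum_eq_of_support_pair
    (fun l k => M.rankTerm (swapAlloc π i j) l k - M.rankTerm π l k) i j hij
    (fun k l => by rw [M.rankTerm_comm hsym _ k l, M.rankTerm_comm hsym _ k l])
    (by simp [M.rankTerm_self]) (by simp [M.rankTerm_self])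
    (by simp [M.rankTerm_swapAlloc])
    (fun k l hki hkj hli hlj => by
      simp [GMP.rankTerm, swapAlloc, Equiv.swap_apply_of_ne_of_ne, hki, hkj, hli, hlj])
  simp only [Finset.sum_sub_distrib] at key
  simp only [GMP.potential, Finset.sum_add_distrib]
  linarith

/-- in a symmetric GMP instance with uniform valuation whose player
graph has all degrees at most two, there is an integer potential `P` with
`0 ≤ P(π) ≤ 6n²` that strictly increases along blocking-pair resolutions;
consequently every improvement path has at most `6n²` resolution steps. -/
theorem stmt7 {N A : Type*} [Fintype N] [Fintype A] (M : GMP N A)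
    (hsym : M.Symm) (c : ℝ) (hc : 0 ≤ c) (hv : ∀ i a, M.v i a = c)
    (hdeg : ∀ i : N, (Finset.univ.filter (fun j => M.tau j i)).card ≤ 2) :
    ∃ P : (N ≃ A) → ℤ,
      (∀ π : N ≃ A, 0 ≤ P π ∧ P π ≤ 6 * (Fintype.card N : ℤ) ^ 2) ∧
      (∀ (π : N ≃ A) (i j : N), M.BlockingPair π i j → P π < P (swapAlloc π i j)) ∧
      (∀ (f : ℕ → N ≃ A) (L : ℕ),
        (∀ k < L, ∃ i j : N,
          M.BlockingPair (f k) i j ∧ f (k + 1) = swapAlloc (f k) i j) →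
        L ≤ 6 * Fintype.card N ^ 2) := by
  have hP : ∀ π : N ≃ A, 0 ≤ M.potential π ∧
      M.potential π ≤ 6 * (Fintype.card N : ℤ) ^ 2 := by
    refine fun π => ⟨M.potential_nonneg π, (M.potential_le π).trans ?_⟩
    have h := M.card_arcs_le hdeg
    have h0 : (0 : ℤ) ≤ M.arcs.card := by positivity
    nlinarith
  have hlt : ∀ (π : N ≃ A) (i j : N), M.BlockingPair π i j →
      M.potential π < M.potential (swapAlloc π i j) :=
    fun π i j h => M.potential_lt_of_blockingPair hsym c hv hdeg h
  refine ⟨M.potential, hP, hlt, fun f L hf => ?_⟩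
  have hk : ∀ k ≤ L, (k : ℤ) ≤ M.potential (f k) := by
    intro k
    induction k with
    | zero => exact fun _ => by simpa using (hP (f 0)).1
    | succ k ih =>
      intro hkL
      obtain ⟨i, j, hb, he⟩ := hf k hkL
      have h1 := ih (by omega)
      have h2 := hlt _ _ _ hb
      rw [he]
      push_cast
      omega
  exact_mod_cast (hk L le_rfl).trans (hP (f L)).2
end

section
/- Let M be a graphical matching problem instance whose player graph G is symmetric and whose item graph is the complete bipartite graph with parts U and V (every item in U is adjacent to every item in V and there are no other edges). Then for every allocation π, φ(π) = Σ_{i : π(i) ∈ U} 2u_i(π) + Σ_{i : π(i) ∈ V} 2v_i(π(i)), where φ(π) = Σ_{i∈N} (v_i(π(i)) + u_i(π)). -/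
open scoped Classical

variable {N A : Type*} [Fintype N] [Fintype A]

/-- Edge weights crossing a set of players are received equally on both sides in a symmetric
instance whose item graph is complete bipartite. -/
theorem GMP.sum_neighbors_part_eq {N A : Type*} [Fintype N] [Fintype A] (M : GMP N A)
    (hsym : M.Symm) (U : Finset A)
    (hlam : ∀ a b : A, M.lam a b ↔ ((a ∈ U ∧ b ∉ U) ∨ (a ∉ U ∧ b ∈ U))) (π : N ≃ A) :
    ∑ i ∈ Finset.univ.filter (fun i : N => π i ∈ U),
        ∑ j ∈ Finset.univ.filter (fun j => M.tau j i ∧ M.lam (π j) (π i)), M.w j i =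
      ∑ i ∈ Finset.univ.filter (fun i : N => π i ∉ U),
        ∑ j ∈ Finset.univ.filter (fun j => M.tau j i ∧ M.lam (π j) (π i)), M.w j i := by
  refine Eq.trans (Finset.sum_comm' (t' := Finset.univ.filter (fun j : N => π j ∉ U))
    (s' := fun j => Finset.univ.filter (fun i => M.tau i j ∧ M.lam (π i) (π j))) ?_) ?_
  · intro i j
    have hij := hsym i j
    have hji := hsym j i
    simp only [Finset.mem_filter, Finset.mem_univ, true_and, hlam]
    tauto
  · refine Finset.sum_congr rfl fun j _ => Finset.sum_congr rfl fun i hi => ?_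
    exact (hsym i j (Finset.mem_filter.mp hi).2.1).2.symm

/-- in a symmetric GMP instance whose item graph is the complete
bipartite graph with parts `U` and its complement `V`, the potential satisfies
`φ(π) = Σ_{π(i) ∈ U} 2 u_i(π) + Σ_{π(i) ∈ V} 2 v_i(π(i))`. -/
theorem stmt8 {N A : Type*} [Fintype N] [Fintype A] (M : GMP N A)
    (hsym : M.Symm) (U : Finset A)
    (hlam : ∀ a b : A, M.lam a b ↔ ((a ∈ U ∧ b ∉ U) ∨ (a ∉ U ∧ b ∈ U)))
    (π : N ≃ A) :
    M.phi π =
      ∑ i ∈ Finset.univ.filter (fun i : N => π i ∈ U), 2 * M.utility π i +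
      ∑ i ∈ Finset.univ.filter (fun i : N => π i ∉ U), 2 * M.v i (π i) := by
  have h := M.sum_neighbors_part_eq hsym U hlam π
  rw [GMP.phi, ← Finset.sum_filter_add_sum_filter_not Finset.univ (fun i : N => π i ∈ U)]
  simp only [GMP.utility, mul_add, Finset.sum_add_distrib, ← Finset.mul_sum]
  linarith
end

section
/- Let M be a graphical matching problem instance whose player graph G is a directed acyclic graph (contains no directed cycle). Then M admits a core stable allocation. -/
open scoped Classical

variable {N A : Type*} [Fintype N] [Fintype A]

/-- A relation without cycles is contained in a strict linear order. -/
theorem exists_linearOrder_of_acyclic {α : Type*} (r : α → α → Prop)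
    (h : ∀ i, ¬ Relation.TransGen r i i) :
    ∃ _ : LinearOrder α, ∀ i j, r i j → i < j := by
  have hpo : IsPartialOrder α (Relation.ReflTransGen r) :=
    { refl := fun _ => Relation.ReflTransGen.refl
      trans := fun _ _ _ => Relation.ReflTransGen.trans
      antisymm := by
        intro a b hab hba
        rcases Relation.reflTransGen_iff_eq_or_transGen.1 hab with hEq | hlt
        · exact hEq.symm
        · exact (h a (hlt.trans_left hba)).elim }
  obtain ⟨s, hs, hle⟩ := extend_partialOrder (Relation.ReflTransGen r)
  let L : LinearOrder α :=
    { le := s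
      le_refl := hs.refl
      le_trans := hs.trans
      le_antisymm := hs.antisymm
      le_total := hs.total
      toDecidableLE := Classical.decRel _ }
  refine ⟨L, fun i j hij => ?_⟩
  refine lt_of_le_of_ne (hle i j (Relation.ReflTransGen.single hij)) ?_
  rintro rfl
  exact h i (Relation.TransGen.single hij)

/-- The utility of a player depends only on the items of the player and its in-neighbours. -/
theorem GMP.utility_congr {N A : Type*} [Fintype N] [Fintype A] (M : GMP N A) {π π' : N ≃ A}
    {i : N} (hi : π' i = π i) (hpred : ∀ j, M.tau j i → π' j = π j) :
    M.utility π' i = M.utility π i := by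
  unfold GMP.utility
  rw [hi]
  congr 2
  ext j
  simp only [Finset.mem_filter, Finset.mem_univ, true_and]
  exact and_congr_right fun hj => by rw [hpred j hj]

/-- if the player graph is a DAG (no directed cycle), then a core
stable allocation exists. -/
theorem stmt9 {N A : Type*} [Fintype N] [Fintype A]
    (hcard : Fintype.card N = Fintype.card A)
    (M : GMP N A) (hdag : ∀ i : N, ¬ Relation.TransGen M.tau i i) :
    ∃ π : N ≃ A, M.CoreStable π := by
  obtain ⟨_, hlt⟩ := exists_linearOrder_of_acyclic M.tau hdag
  have : Nonempty (N ≃ A) := ⟨Fintype.equivOfCardEq hcard⟩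
  obtain ⟨π, hmax⟩ := Finite.exists_max fun π : N ≃ A => toLex (M.utility π)
  refine ⟨π, ?_⟩
  rintro X ⟨π', hX, μ, -, hout, hin⟩
  obtain ⟨i, hiX, hmin⟩ := X.exists_min_image id hX
  have hbelow : ∀ k < i, π' k = π k := fun k hk =>
    hout k fun hkX => (hmin k hkX).not_gt hk
  refine (hmax π').not_gt ⟨i, fun k hk => ?_, (hin i hiX).2.2⟩
  exact (M.utility_congr (hbelow k hk) fun j hj => hbelow j ((hlt j k hj).trans hk)).symm
end

section
/- Let M be a graphical matching problem instance whose player graph G is a directed acyclic graph, and let i₁, i₂, ..., iₙ be a topological ordering of the players (i.e., (j,i) ∈ τ implies j appears before i in the ordering). Suppose π is an allocation such that for every index k and every item a ∉ {π(i₁), ..., π(i_{k−1})}, v_{i_k}(π(i_k)) + Σ_{l < k, (i_l, i_k) ∈ τ, (π(i_l), π(i_k)) ∈ λ} w_{i_l, i_k} ≥ v_{i_k}(a) + Σ_{l < k, (i_l, i_k) ∈ τ, (π(i_l), a) ∈ λ} w_{i_l, i_k} (each player, in topological order, receives an unassigned item maximizing its utility). Then π is core stable. -/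
open scoped Classical

variable {N A : Type*} [Fintype N] [Fintype A]

/-- The utility of `i` depends only on its own item and on the items of the players
preceding it in a topological ordering. -/
theorem GMP.utility_eq_of_eq_on_predecessors {N A : Type*} [Fintype N] [Fintype A]
    (M : GMP N A) {g : N → ℕ} (htopo : ∀ j i : N, M.tau j i → g j < g i) (i : N)
    (π ρ : N ≃ A) (h : ∀ j, g j < g i → ρ j = π j) :
    M.utility ρ i = M.v i (ρ i) + ∑ j ∈ Finset.univ.filter
      (fun j => g j < g i ∧ M.tau j i ∧ M.lam (π j) (ρ i)), M.w j i := by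
  unfold GMP.utility
  congr 1
  refine Finset.sum_congr ?_ fun _ _ => rfl
  ext j
  simp only [Finset.mem_filter, Finset.mem_univ, true_and]
  constructor
  · rintro ⟨h₁, h₂⟩
    exact ⟨htopo j i h₁, h₁, h j (htopo j i h₁) ▸ h₂⟩
  · rintro ⟨h₁, h₂, h₃⟩
    exact ⟨h₂, (h j h₁).symm ▸ h₃⟩

/-- if the player graph is a DAG with topological ordering `g`
(i.e. `g` is injective and `(j,i) ∈ τ → g j < g i`), and `π` greedily gives each
player, in topological order, an item maximizing its utility among the items not
assigned to earlier players, then `π` is core stable. -/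
theorem stmt10 {N A : Type*} [Fintype N] [Fintype A] (M : GMP N A)
    (g : N → ℕ) (hg : Function.Injective g)
    (htopo : ∀ j i : N, M.tau j i → g j < g i)
    (π : N ≃ A)
    (hgreedy : ∀ (i : N) (a : A), (∀ l : N, g l < g i → π l ≠ a) →
      M.v i a + ∑ j ∈ Finset.univ.filter
          (fun j => g j < g i ∧ M.tau j i ∧ M.lam (π j) a), M.w j i ≤
      M.v i (π i) + ∑ j ∈ Finset.univ.filter
          (fun j => g j < g i ∧ M.tau j i ∧ M.lam (π j) (π i)), M.w j i) :
    M.CoreStable π := by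
  rintro X ⟨π', hne, μ, hμ, hfix, hX⟩
  obtain ⟨i, hiX, hmin⟩ := X.exists_min_image g hne
  obtain ⟨hμi, -, hlt⟩ := hX i hiX
  have hπ' : ∀ j, g j < g i → π' j = π j := fun j hj =>
    hfix j fun hjX => (hmin j hjX).not_gt hj
  have hfree : ∀ l, g l < g i → π l ≠ π' i := by
    intro l hl h
    rw [hμi] at h
    rw [π.injective h] at hl
    exact (hmin _ (hμ.mapsTo hiX)).not_gt hl
  rw [M.utility_eq_of_eq_on_predecessors htopo i π π fun _ _ => rfl,
    M.utility_eq_of_eq_on_predecessors htopo i π π' hπ'] at hlt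
  exact hlt.not_ge (hgreedy i (π' i) hfree)
end

section
/- Consider the GMP instance with players N = {1,...,6}, player graph the directed cycle τ = {(i, i+1) : 1 ≤ i ≤ 5} ∪ {(6,1)} with all edge weights equal to 1, uniform zero valuations, and item graph on items {a₂, a₄, a₆, b₁, b₃, b₅} with edges {a₂,a₄}, {a₄,a₆}, {a₆,a₂}, {b₁,a₂}, {b₃,a₄}, {b₅,a₆}. Then the allocation π with π(2) = a₂, π(4) = a₄, π(6) = a₆, π(1) = b₁, π(3) = b₃, π(5) = b₅ is 2-stable but not core stable (the set X = {1,3,5} is a blocking coalition in π). -/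
open scoped Classical

variable {N A : Type*} [Fintype N] [Fintype A]

/-- The six-player instance of Figure 3: players `0,…,5` (players `1,…,6` of the
paper) on the directed cycle with all edge weights 1, zero valuations; items
`0,…,5` stand for `b₁, a₂, b₃, a₄, b₅, a₆`, with the triangle `{a₂,a₄,a₆}`
(odd indices) and the pendant edges `{b₁,a₂}, {b₃,a₄}, {b₅,a₆}`. -/
def figGMP : GMP (Fin 6) (Fin 6) where
  tau i j := j = i + 1
  w _ _ := 1
  noSelf := by decide
  lam a b := (Odd a.val ∧ Odd b.val ∧ a ≠ b) ∨ (a.val + 1 = b.val ∧ Even a.val) ∨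
    (b.val + 1 = a.val ∧ Even b.val)
  lamSymm := by decide
  lamIrrefl := by decide
  v _ _ := 0
  vNonneg _ _ := le_refl 0

/-- The only in-neighbour of `i` is `i - 1`, so a player strictly gains exactly when its item
becomes adjacent to that of its predecessor. -/
theorem figGMP_utility_lt_iff (π π' : Fin 6 ≃ Fin 6) (i : Fin 6) :
    figGMP.utility π i < figGMP.utility π' i ↔
      ¬ figGMP.lam (π (i - 1)) (π i) ∧ figGMP.lam (π' (i - 1)) (π' i) := by
  have utility_eq (σ : Fin 6 ≃ Fin 6) : figGMP.utility σ i =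
      if figGMP.lam (σ (i - 1)) (σ i) then 1 else 0 := by
    have hfilter : (Finset.univ.filter
        fun j => figGMP.tau j i ∧ figGMP.lam (σ j) (σ i)) =
        if figGMP.lam (σ (i - 1)) (σ i) then {i - 1} else ∅ := by
      have tau_iff (j : Fin 6) : figGMP.tau j i ↔ j = i - 1 := by
        rw [eq_sub_iff_add_eq]
        exact eq_comm
      ext j
      split_ifs with h <;> simp only [Finset.mem_filter, Finset.mem_univ, true_and, tau_iff,
        Finset.mem_singleton, Finset.notMem_empty] <;> grind
    unfold GMP.utility
    rw [hfilter]
    split_ifs <;> simp [figGMP]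
  rw [utility_eq, utility_eq]
  split_ifs <;> simp_all

theorem swapAlloc_refl_apply (i j k : Fin 6) :
    swapAlloc (Equiv.refl (Fin 6)) i j k = if k = i then j else if k = j then i else k := by
  simp only [swapAlloc, Equiv.trans_apply, Equiv.refl_apply, Equiv.swap_apply_def]
  split_ifs <;> rfl

/-- The rotation of items `0 ↦ 4 ↦ 2 ↦ 0`. -/
def evenRotation : Fin 6 ≃ Fin 6 where
  toFun := ![4, 1, 0, 3, 2, 5]
  invFun := ![2, 1, 4, 3, 0, 5]
  left_inv := by decide
  right_inv := by decide

/-- the identity allocation (player `1 ↦ b₁`, `2 ↦ a₂`, …, `6 ↦ a₆`)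
is 2-stable but not core stable; the players `{1,3,5}` (indices `{0,2,4}`) form a
blocking coalition. -/
theorem stmt13 :
    figGMP.TwoStable (Equiv.refl (Fin 6)) ∧
    figGMP.BlockingCoalition (Equiv.refl (Fin 6)) {0, 2, 4} ∧
    ¬ figGMP.CoreStable (Equiv.refl (Fin 6)) := by
  have twoStable : figGMP.TwoStable (Equiv.refl (Fin 6)) := by
    rintro i j ⟨hne, hi, hj⟩
    rw [figGMP_utility_lt_iff] at hi hj
    simp only [swapAlloc_refl_apply, Equiv.refl_apply, figGMP] at hi hj
    revert i j
    decide
  have blocking : figGMP.BlockingCoalition (Equiv.refl (Fin 6)) {0, 2, 4} := by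
    refine ⟨evenRotation, by simp, evenRotation, ⟨?_, evenRotation.injective.injOn, ?_⟩, ?_, ?_⟩
    · intro i hi
      revert i
      simp [evenRotation]
    · intro i hi
      refine ⟨evenRotation.symm i, ?_, evenRotation.apply_symm_apply i⟩
      revert i
      simp [evenRotation]
    · decide
    · intro i hi
      rw [figGMP_utility_lt_iff]
      simp only [figGMP, Equiv.refl_apply]
      revert i
      decide
  exact ⟨twoStable, blocking, fun h => h _ blocking⟩
end

section
/- Consider the GMP instance with players N = {1,...,6}, player graph the directed cycle τ = {(i, i+1) : 1 ≤ i ≤ 5} ∪ {(6,1)} with all edge weights equal to 1, uniform zero valuations, and item graph on items {a₂, a₄, a₆, b₁, b₃, b₅} with edges {a₂,a₄}, {a₄,a₆}, {a₆,a₂}, {b₁,a₂}, {b₃,a₄}, {b₅,a₆}, and the allocation π with π(2) = a₂, π(4) = a₄, π(6) = a₆, π(1) = b₁, π(3) = b₃, π(5) = b₅. Then there exists an infinite sequence of allocations π⁰ = π, π¹, π², ... such that for every k ≥ 1, the allocation π^k is obtained from π^{k-1} by resolving a blocking coalition (i.e., there is a blocking coalition X in π^{k-1} witnessed by π^k); in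 particular, coalition improvement dynamics in this instance need not terminate. -/
open scoped Classical

variable {N A : Type*} [Fintype N] [Fintype A]

/-- In `figGMP` a player's utility is `1` if their item is adjacent to their predecessor's item,
and `0` otherwise. -/
lemma figGMP_utility (π : Fin 6 ≃ Fin 6) (i : Fin 6) :
    figGMP.utility π i = if figGMP.lam (π (i - 1)) (π i) then 1 else 0 := by
  have h (j : Fin 6) : i = j + 1 ↔ j = i - 1 := by rw [eq_sub_iff_add_eq, eq_comm]
  simp only [GMP.utility, Finset.sum_filter, ite_and]
  simp [figGMP, h]

lemma figGMP_utility_lt {π π' : Fin 6 ≃ Fin 6} {i : Fin 6}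
    (h : ¬ figGMP.lam (π (i - 1)) (π i)) (h' : figGMP.lam (π' (i - 1)) (π' i)) :
    figGMP.utility π i < figGMP.utility π' i := by
  simp [figGMP_utility, h, h']

/-- The total shift of player `i`'s item after `k` steps of the dynamics in which the players of
even index and those of odd index alternately rotate their items. -/
def cycleShift (k i : Fin 6) : Fin 6 :=
  Fin.ofNat 6 (2 * ((k.val + 1 - i.val % 2) / 2))

/-- The `6`-periodic sequence of allocations in which the players of even index and those of odd
index alternately rotate their items. -/
def cycleAlloc (k : Fin 6) : Fin 6 ≃ Fin 6 where
  toFun i := i - cycleShift k i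
  invFun i := i + cycleShift k i
  left_inv := by decide +revert
  right_inv := by decide +revert

lemma figGMP_blocksVia_cycleAlloc (k : Fin 6) :
    figGMP.BlocksVia (cycleAlloc k) {i | i.val % 2 = k.val % 2} (cycleAlloc (k + 1)) := by
  refine ⟨by decide +revert, fun i => i - 2, ⟨?_, sub_left_injective.injOn, ?_⟩,
    by decide +revert, ?_⟩
  · simp only [Set.MapsTo, Finset.mem_coe]
    decide +revert
  · simp only [Set.SurjOn, Set.subset_def, Set.mem_image, Finset.mem_coe]
    decide +revert
  · have key : ∀ k i : Fin 6, i.val % 2 = k.val % 2 →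
        cycleAlloc (k + 1) i = cycleAlloc k (i - 2) ∧ cycleAlloc (k + 1) i ≠ cycleAlloc k i := by
      decide
    have before : ∀ k i : Fin 6, i.val % 2 = k.val % 2 →
        ¬ figGMP.lam (cycleAlloc k (i - 1)) (cycleAlloc k i) := by
      unfold figGMP
      decide
    have after : ∀ k i : Fin 6, i.val % 2 = k.val % 2 →
        figGMP.lam (cycleAlloc (k + 1) (i - 1)) (cycleAlloc (k + 1) i) := by
      unfold figGMP
      decide
    intro i hi
    have hi' : i.val % 2 = k.val % 2 := by simpa using hi
    exact ⟨(key k i hi').1, (key k i hi').2, figGMP_utility_lt (before k i hi') (after k i hi')⟩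

/-- starting from the identity allocation of `figGMP`, there is an
infinite sequence of allocations in which each allocation is obtained from the
previous one by resolving a blocking coalition: coalition improvement dynamics need
not terminate. -/
theorem stmt14 :
    ∃ f : ℕ → (Fin 6 ≃ Fin 6), f 0 = Equiv.refl (Fin 6) ∧
      ∀ k : ℕ, ∃ X : Finset (Fin 6), figGMP.BlocksVia (f k) X (f (k + 1)) := by
  refine ⟨fun k => cycleAlloc (Fin.ofNat 6 k), by decide, fun k => ?_⟩
  have h : Fin.ofNat 6 (k + 1) = Fin.ofNat 6 k + 1 := by simp [Fin.ext_iff, Fin.val_add]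
  beta_reduce
  rw [h]
  exact ⟨_, figGMP_blocksVia_cycleAlloc (Fin.ofNat 6 k)⟩
end

section
/- Let M be a graphical matching problem instance whose item graph H is either complete (every two distinct items are adjacent) or empty (λ = ∅). Then M admits a core stable allocation. -/
open scoped Classical

variable {N A : Type*} [Fintype N] [Fintype A]

/-- If any two distinct items are adjacent, or no two are, then the part of a player's utility
coming from the other players does not depend on the allocation. -/
theorem GMP.utility_sub_eq_of_complete_or_empty {N A : Type*} [Fintype N] [Fintype A]
    (M : GMP N A) (h : (∀ a b : A, a ≠ b → M.lam a b) ∨ (∀ a b : A, ¬ M.lam a b))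
    (π π' : N ≃ A) (i : N) :
    M.utility π i - M.v i (π i) = M.utility π' i - M.v i (π' i) := by
  have hfilter : ∀ j, (M.tau j i ∧ M.lam (π j) (π i)) ↔ (M.tau j i ∧ M.lam (π' j) (π' i)) := by
    intro j
    refine and_congr_right fun hτ => ?_
    have hne : j ≠ i := fun hji => M.noSelf i (hji ▸ hτ)
    rcases h with h | h
    · exact iff_of_true (h _ _ (π.injective.ne hne)) (h _ _ (π'.injective.ne hne))
    · exact iff_of_false (h _ _) (h _ _)
  simp only [GMP.utility, hfilter, add_sub_cancel_left]

/-- An allocation of maximal total value is core stable if utilities and values differ by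
quantities independent of the allocation. -/
theorem GMP.coreStable_of_forall_sum_le {N A : Type*} [Fintype N] [Fintype A] (M : GMP N A)
    (hu : ∀ (π π' : N ≃ A) (i : N),
      M.utility π i - M.v i (π i) = M.utility π' i - M.v i (π' i))
    (π : N ≃ A) (hmax : ∀ π' : N ≃ A, ∑ i, M.v i (π' i) ≤ ∑ i, M.v i (π i)) :
    M.CoreStable π := by
  rintro X ⟨π', ⟨x, hx⟩, μ, -, hout, hin⟩
  refine (hmax π').not_gt ?_
  have hlt : ∀ i ∈ X, M.v i (π i) < M.v i (π' i) := fun i hi => by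
    linarith [hu π π' i, (hin i hi).2.2]
  refine Finset.sum_lt_sum (fun i _ => ?_) ⟨x, Finset.mem_univ x, hlt x hx⟩
  by_cases hi : i ∈ X
  · exact (hlt i hi).le
  · rw [hout i hi]

/-- if the item graph is complete or empty, a core stable allocation
exists. -/
theorem stmt17 {N A : Type*} [Fintype N] [Fintype A]
    (hcard : Fintype.card N = Fintype.card A)
    (M : GMP N A)
    (h : (∀ a b : A, a ≠ b → M.lam a b) ∨ (∀ a b : A, ¬ M.lam a b)) :
    ∃ π : N ≃ A, M.CoreStable π := by
  have : Nonempty (N ≃ A) := ⟨Fintype.equivOfCardEq hcard⟩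
  obtain ⟨π, hπ⟩ := Finite.exists_max fun π : N ≃ A => ∑ i, M.v i (π i)
  exact ⟨π, M.coreStable_of_forall_sum_le (M.utility_sub_eq_of_complete_or_empty h) π hπ⟩
end
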